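/- (Deterministic perfect tamper detection.) Let h : β → α be an injective leaf-hash function and H : α → α → α a pairwise injective combiner. Let L be a nonempty log committed to a Merkle tree with anchored root R = root(L.map h), and let L' be a stored copy of the same length in which exactly the entries at a set S of indices have been modified (L'[i] ≠ L[i] for i ∈ S and L'[i] = L[i] otherwise). Define the detector to flag index i if and only if recomputing the root from h(L'[i]) and the inclusion proof for index i generated from the original tree does not equal R. Then the set of flagged indices equals S exactly; in particular the detector has no false positives and no false negatives. -/

import Mathlib

/-- Side of a sibling hash in an inclusion proof. -/
inductive Side
  | left
  | right
deriving DecidableEq, Repr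

/-- One Merkle level step: combine consecutive pairs with `H`,
promoting an unpaired final element unchanged. -/
def levelStep {α : Type*} (H : α → α → α) : List α → List α
  | a :: b :: rest => H a b :: levelStep H rest
  | l => l

theorem levelStep_length {α : Type*} (H : α → α → α) :
    (l : List α) → (levelStep H l).length = (l.length + 1) / 2
  | [] => by simp [levelStep]
  | [_] => by simp [levelStep]
  | a :: b :: rest => by
      simp only [levelStep, List.length_cons, levelStep_length H rest]
      omega

/-- The Merkle root of a list of leaf hashes (`none` on the empty list),
obtained by iterating the level step until a single hash remains. -/
def merkleRoot? {α : Type*} (H : α → α → α) : List α → Option α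
  | [] => none
  | [a] => some a
  | a :: b :: rest => merkleRoot? H (levelStep H (a :: b :: rest))
termination_by l => l.length
decreasing_by
  simp only [levelStep_length, List.length_cons]
  omega

/-- The inclusion proof for leaf index `i`: the list of sibling hashes,
tagged with their side, along the path from leaf `i` to the root. -/
def merkleProof {α : Type*} (H : α → α → α) : List α → ℕ → List (Side × α)
  | [], _ => []
  | [_], _ => []
  | (a :: b :: rest), i =>
      (if i % 2 = 0 then
        match (a :: b :: rest)[i + 1]? with
        | some s => [(Side.right, s)]
        | none => []
      else
        match (a :: b :: rest)[i - 1]? with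
        | some s => [(Side.left, s)]
        | none => []) ++ merkleProof H (levelStep H (a :: b :: rest)) (i / 2)
termination_by l _ => l.length
decreasing_by
  simp only [levelStep_length, List.length_cons]
  omega

/-- Recompute a candidate root from a leaf hash and an inclusion proof. -/
def recomputeRoot {α : Type*} (H : α → α → α) (h : α) (π : List (Side × α)) : α :=
  π.foldl (fun acc p =>
    match p.1 with
    | Side.left => H p.2 acc
    | Side.right => H acc p.2) h

theorem levelStep_pair {α : Type*} (H : α → α → α) (k : ℕ) : ∀ (l : List α) (x y : α),
    l[2*k]? = some x → l[2*k+1]? = some y → (levelStep H l)[k]? = some (H x y) := by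
  induction k with
  | zero =>
    rintro (_ | ⟨a, _ | ⟨b, r⟩⟩) x y h1 h2 <;> simp_all [levelStep]
  | succ k ih =>
    rintro (_ | ⟨a, _ | ⟨b, r⟩⟩) x y h1 h2
    · simp at h1
    · simp at h2
    · have := ih r x y (by simpa [Nat.mul_add] using h1) (by simpa [Nat.mul_add] using h2)
      simpa [levelStep] using this

theorem levelStep_single {α : Type*} (H : α → α → α) (k : ℕ) : ∀ (l : List α) (x : α),
    l[2*k]? = some x → l[2*k+1]? = none → (levelStep H l)[k]? = some x := by
  induction k with
  | zero =>
    rintro (_ | ⟨a, _ | ⟨b, r⟩⟩) x h1 h2 <;> simp_all [levelStep]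
  | succ k ih =>
    rintro (_ | ⟨a, _ | ⟨b, r⟩⟩) x h1 h2
    · simp at h1
    · simp [Nat.mul_add] at h1
    · have := ih r x (by simpa [Nat.mul_add] using h1) (by simpa [Nat.mul_add] using h2)
      simpa [levelStep] using this

theorem recompute_complete {α : Type*} (H : α → α → α) (n : ℕ) : ∀ (l : List α) (i : ℕ) (x : α),
    l.length = n → l[i]? = some x →
    some (recomputeRoot H x (merkleProof H l i)) = merkleRoot? H l := by
  induction n using Nat.strong_induction_on with
  | _ n ih =>
    rintro (_ | ⟨a, _ | ⟨b, r⟩⟩) i x hn hx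
    · simp at hx
    · have hi : i = 0 := by
        by_contra h
        simp [h] at hx
      subst hi
      simp at hx
      simp [merkleProof, merkleRoot?, recomputeRoot, hx]
    · rw [merkleProof, merkleRoot?]
      have hl : (levelStep H (a :: b :: r)).length < n := by
        rw [levelStep_length, ← hn]; simp only [List.length_cons]; omega
      have key := fun z hz => ih _ hl (levelStep H (a :: b :: r)) (i/2) z rfl hz
      generalize a :: b :: r = l at *
      split_ifs with he
      · obtain ⟨k, rfl⟩ : ∃ k, i = 2 * k := ⟨i / 2, by omega⟩
        have hk : 2 * k / 2 = k := by omega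
        rw [hk] at key ⊢
        rcases hy : l[2*k+1]? with _ | y
        · simpa [recomputeRoot] using key x (levelStep_single H k l x hx hy)
        · simpa [recomputeRoot] using key _ (levelStep_pair H k l x y hx hy)
      · obtain ⟨k, rfl⟩ : ∃ k, i = 2 * k + 1 := ⟨i / 2, by omega⟩
        have hk : (2 * k + 1) / 2 = k := by omega
        rw [hk] at key ⊢
        rw [Nat.add_sub_cancel]
        rcases hy : l[2*k]? with _ | y
        · rw [List.getElem?_eq_none_iff] at hy
          rw [List.getElem?_eq_none (by omega)] at hx
          cases hx
        · simpa [recomputeRoot] using key _ (levelStep_pair H k l y x hy hx)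

theorem recompute_inj {α : Type*} (H : α → α → α)
    (hH : ∀ a b c d : α, H a b = H c d → a = c ∧ b = d) (p : List (Side × α)) :
    ∀ x y, recomputeRoot H x p = recomputeRoot H y p → x = y := by
  induction p with
  | nil => intro x y h; exact h
  | cons s p ih =>
    obtain ⟨s, z⟩ := s
    intro x y h
    cases s
    · exact (hH _ _ _ _ (ih (H z x) (H z y) h)).2
    · exact (hH _ _ _ _ (ih (H x z) (H y z) h)).1

/-- **Deterministic perfect tamper detection.** Let `L` be a nonempty log
committed to a Merkle tree with anchored root `R = merkleRoot? H (L.map hf)`,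
and let `L'` be a stored copy of the same length in which exactly the entries
at a set `S` of indices have been modified. The detector flags index `i` iff
recomputing the root from `hf L'[i]` and the inclusion proof for index `i`
generated from the original tree does not equal `R`. Then the set of flagged
indices equals `S` exactly: no false positives and no false negatives. -/
theorem tamper_detection_exact {α β : Type*} (hf : β → α)
    (hfinj : Function.Injective hf) (H : α → α → α)
    (hH : ∀ a b c d : α, H a b = H c d → a = c ∧ b = d)
    (L L' : List β) (hne : L ≠ []) (hlen : L.length = L'.length)
    (S : Set ℕ)
    (hS : ∀ i (hi : i < L.length), i ∈ S ↔ L'[i]'(hlen ▸ hi) ≠ L[i])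
    (i : ℕ) (hi : i < L.length) :
    some (recomputeRoot H (hf (L'[i]'(hlen ▸ hi))) (merkleProof H (L.map hf) i)) ≠
        merkleRoot? H (L.map hf) ↔ i ∈ S := by
  have hc := recompute_complete H _ (L.map hf) i (hf L[i]) rfl (by simp [hi])
  rw [hS i hi, ← hc, not_iff_not, Option.some_inj]
  constructor
  · intro h
    exact hfinj (recompute_inj H hH _ _ _ h)
  · intro h
    rw [h]
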